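/- For all x > 0 and all ν ≥ 1/2, I_ν(x) K_ν(x) - 1/(2x) < 1/(16 x²). -/

import Mathlib

open Real MeasureTheory Set Filter

/-- Modified Bessel function of the first kind `I_ν`. -/
noncomputable def besselI (ν x : ℝ) : ℝ :=
  ∑' n : ℕ, (x / 2) ^ (2 * (n : ℝ) + ν) / ((n.factorial : ℝ) * Real.Gamma ((n : ℝ) + ν + 1))

/-- Modified Bessel function of the second kind `K_ν`. -/
noncomputable def besselK (ν x : ℝ) : ℝ :=
  ∫ t in Ioi (0 : ℝ), Real.exp (-x * Real.cosh t) * Real.cosh (ν * t)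

/-- Bessel function of the first kind `J_ν`. -/
noncomputable def besselJ (ν x : ℝ) : ℝ :=
  ∑' n : ℕ, (-1 : ℝ) ^ n * (x / 2) ^ (2 * (n : ℝ) + ν) /
    ((n.factorial : ℝ) * Real.Gamma ((n : ℝ) + ν + 1))

/-- Modified Struve function of the first kind `L_ν`. -/
noncomputable def struveL (ν x : ℝ) : ℝ :=
  ∑' n : ℕ, (x / 2) ^ (2 * (n : ℝ) + ν + 1) /
    (Real.Gamma ((n : ℝ) + 3 / 2) * Real.Gamma ((n : ℝ) + ν + 3 / 2))

/-- Airy function `Ai`. -/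
noncomputable def airyAi (t : ℝ) : ℝ :=
  (1 / Real.pi) * ∫ s in Ioi (0 : ℝ), Real.cos (s ^ 3 / 3 + s * t)

/-- Landau constant `b_L = 2^{1/3} ⬝ sup_{t ≥ 0} Ai(t)`. -/
noncomputable def landau_bL : ℝ :=
  (2 : ℝ) ^ ((1 : ℝ) / 3) * sSup (airyAi '' Ici 0)

/-- Landau constant `c_L = sup_{t ≥ 0} t^{1/3} J₀(t)`. -/
noncomputable def landau_cL : ℝ :=
  sSup ((fun t : ℝ => t ^ ((1 : ℝ) / 3) * besselJ 0 t) '' Ici 0)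

/-- The entire function `z ↦ ∑ zⁿ / (n! Γ(n + ν + 1))`, with `I_ν(x) = (x/2)^ν F_ν(x²/4)`. -/
noncomputable def besselSeries (ν z : ℝ) : ℝ :=
  ∑' n : ℕ, z ^ n / ((n.factorial : ℝ) * Real.Gamma ((n : ℝ) + ν + 1))

lemma Gamma_le_Gamma_nat_add {ν : ℝ} (hν : 0 ≤ ν) (n : ℕ) :
    Real.Gamma (ν + 1) ≤ Real.Gamma ((n : ℝ) + ν + 1) := by
  induction n with
  | zero => simp
  | succ n ih =>
    have hpos : 0 < Real.Gamma ((n : ℝ) + ν + 1) := Real.Gamma_pos_of_pos (by positivity)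
    have h : Real.Gamma (((n + 1 : ℕ) : ℝ) + ν + 1)
        = ((n : ℝ) + ν + 1) * Real.Gamma ((n : ℝ) + ν + 1) := by
      rw [← Real.Gamma_add_one (by positivity)]
      push_cast
      ring_nf
    rw [h]
    have hn : (0 : ℝ) ≤ n := n.cast_nonneg
    nlinarith

lemma norm_besselSeries_term_le {ν : ℝ} (hν : 0 ≤ ν) (z : ℝ) (n : ℕ) :
    ‖z ^ n / ((n.factorial : ℝ) * Real.Gamma ((n : ℝ) + ν + 1))‖
      ≤ (Real.Gamma (ν + 1))⁻¹ * (|z| ^ n / n.factorial) := by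
  have h0 : 0 < Real.Gamma (ν + 1) := Real.Gamma_pos_of_pos (by positivity)
  have h1 := Gamma_le_Gamma_nat_add hν n
  have h2 : (0 : ℝ) < n.factorial := by positivity
  rw [Real.norm_eq_abs, abs_div, abs_pow, abs_of_pos (mul_pos h2 (h0.trans_le h1)),
    ← div_eq_inv_mul, div_div]
  gcongr

lemma summable_besselSeries {ν : ℝ} (hν : 0 ≤ ν) (z : ℝ) :
    Summable fun n : ℕ => z ^ n / ((n.factorial : ℝ) * Real.Gamma ((n : ℝ) + ν + 1)) :=
  Summable.of_norm_bounded ((Real.summable_pow_div_factorial |z|).mul_left _)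
    (norm_besselSeries_term_le hν z)

lemma hasDerivAt_besselSeries {ν : ℝ} (hν : 0 ≤ ν) (z : ℝ) :
    HasDerivAt (besselSeries ν) (besselSeries (ν + 1) z) z := by
  set g' : ℕ → ℝ → ℝ := fun n z =>
    (n * z ^ (n - 1)) / ((n.factorial : ℝ) * Real.Gamma ((n : ℝ) + ν + 1)) with hg'
  have hsucc (n : ℕ) (y : ℝ) : g' (n + 1) y
      = y ^ n / ((n.factorial : ℝ) * Real.Gamma ((n : ℝ) + (ν + 1) + 1)) := by
    have hG : Real.Gamma (((n + 1 : ℕ) : ℝ) + ν + 1) = Real.Gamma ((n : ℝ) + (ν + 1) + 1) := by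
      push_cast; ring_nf
    have h2 : (0 : ℝ) < n.factorial := by positivity
    have h3 : Real.Gamma ((n : ℝ) + (ν + 1) + 1) ≠ 0 :=
      (Real.Gamma_pos_of_pos (by positivity)).ne'
    simp only [hg', hG, Nat.factorial_succ, Nat.add_sub_cancel]
    push_cast
    field_simp
  have hzero (y : ℝ) : g' 0 y = 0 := by simp [hg']
  have hν1 : 0 ≤ ν + 1 := by positivity
  let u : ℕ → ℝ := fun n => if n = 0 then 0 else
    (Real.Gamma (ν + 1 + 1))⁻¹ * ((|z| + 1) ^ (n - 1) / (n - 1).factorial)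
  have hu : Summable u := by
    rw [← summable_nat_add_iff 1]
    simpa [u] using (Real.summable_pow_div_factorial (|z| + 1)).mul_left
      (Real.Gamma (ν + 1 + 1))⁻¹
  have hsum : Summable fun n => g' n z := by
    rw [← summable_nat_add_iff 1]
    simpa only [hsucc] using summable_besselSeries hν1 z
  have key := hasDerivAt_tsum_of_isPreconnected (𝕜 := ℝ) (y₀ := z) (y := z) hu
    (Metric.isOpen_ball (x := z) (ε := 1)) (convex_ball z 1).isPreconnected
    (g := fun (n : ℕ) z => z ^ n / ((n.factorial : ℝ) * Real.Gamma ((n : ℝ) + ν + 1))) (g' := g')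
    (fun n y _ => (hasDerivAt_pow n y).div_const _) ?_ (Metric.mem_ball_self one_pos)
    (summable_besselSeries hν z) (Metric.mem_ball_self one_pos)
  · rw [hsum.tsum_eq_zero_add, hzero, zero_add] at key
    simp only [hsucc] at key
    exact key
  · intro n y hy
    cases n with
    | zero => simp [hzero, u]
    | succ n =>
      have hy' : |y| ≤ |z| + 1 := by
        rw [Metric.mem_ball, Real.dist_eq] at hy
        have := abs_sub_abs_le_abs_sub y z
        linarith
      have hG : 0 < Real.Gamma (ν + 1 + 1) := Real.Gamma_pos_of_pos (by positivity)
      rw [hsucc]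
      refine (norm_besselSeries_term_le hν1 y n).trans ?_
      simp only [u, Nat.add_sub_cancel, Nat.succ_ne_zero, if_false]
      gcongr

lemma besselSeries_recurrence {ν : ℝ} (hν : 0 ≤ ν) (z : ℝ) :
    besselSeries ν z = (ν + 1) * besselSeries (ν + 1) z + z * besselSeries (ν + 2) z := by
  have s0 := summable_besselSeries hν z
  have s1 := summable_besselSeries (ν := ν + 1) (by positivity) z
  have s2 := summable_besselSeries (ν := ν + 2) (by positivity) z
  have hterm (n : ℕ) : z ^ n / ((n.factorial : ℝ) * Real.Gamma ((n : ℝ) + ν + 1))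
      = (ν + 1) * (z ^ n / ((n.factorial : ℝ) * Real.Gamma ((n : ℝ) + (ν + 1) + 1)))
        + n * (z ^ n / ((n.factorial : ℝ) * Real.Gamma ((n : ℝ) + (ν + 1) + 1))) := by
    have hG : Real.Gamma ((n : ℝ) + (ν + 1) + 1)
        = ((n : ℝ) + ν + 1) * Real.Gamma ((n : ℝ) + ν + 1) := by
      rw [← Real.Gamma_add_one (by positivity)]
      ring_nf
    have h2 : (0 : ℝ) < n.factorial := by positivity
    have h3 : Real.Gamma ((n : ℝ) + ν + 1) ≠ 0 := (Real.Gamma_pos_of_pos (by positivity)).ne'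
    have h4 : (n : ℝ) + ν + 1 ≠ 0 := by positivity
    rw [hG]
    field_simp
    ring
  have hshift (n : ℕ) : ((n + 1 : ℕ) : ℝ) * (z ^ (n + 1) /
        (((n + 1).factorial : ℝ) * Real.Gamma (((n + 1 : ℕ) : ℝ) + (ν + 1) + 1)))
      = z * (z ^ n / ((n.factorial : ℝ) * Real.Gamma ((n : ℝ) + (ν + 2) + 1))) := by
    have hG : Real.Gamma (((n + 1 : ℕ) : ℝ) + (ν + 1) + 1)
        = Real.Gamma ((n : ℝ) + (ν + 2) + 1) := by
      push_cast; ring_nf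
    have h2 : (0 : ℝ) < n.factorial := by positivity
    have h3 : Real.Gamma ((n : ℝ) + (ν + 2) + 1) ≠ 0 :=
      (Real.Gamma_pos_of_pos (by positivity)).ne'
    rw [hG, Nat.factorial_succ]
    push_cast
    field_simp
    ring
  have s3 : Summable fun n : ℕ =>
      (n : ℝ) * (z ^ n / ((n.factorial : ℝ) * Real.Gamma ((n : ℝ) + (ν + 1) + 1))) := by
    rw [← summable_nat_add_iff 1]
    simpa only [hshift] using s2.mul_left z
  unfold besselSeries
  rw [tsum_congr hterm, (s1.mul_left _).tsum_add s3, tsum_mul_left, s3.tsum_eq_zero_add]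
  simp only [hshift, tsum_mul_left, Nat.cast_zero, zero_mul, zero_add]

lemma besselSeries_pos {ν z : ℝ} (hν : 0 ≤ ν) (hz : 0 ≤ z) : 0 < besselSeries ν z := by
  have hG (n : ℕ) : 0 < Real.Gamma ((n : ℝ) + ν + 1) := Real.Gamma_pos_of_pos (by positivity)
  refine (summable_besselSeries hν z).tsum_pos
    (fun n => div_nonneg (by positivity) (mul_pos (by positivity) (hG n)).le) 0 ?_
  simpa using hG 0

lemma besselSeries_zero (ν : ℝ) : besselSeries ν 0 = (Real.Gamma (ν + 1))⁻¹ := by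
  unfold besselSeries
  rw [tsum_eq_single 0 fun n hn => by simp [hn]]
  simp

lemma besselI_eq_besselSeries (ν : ℝ) {x : ℝ} (hx : 0 < x) :
    besselI ν x = (x / 2) ^ ν * besselSeries ν (x ^ 2 / 4) := by
  unfold besselI besselSeries
  rw [← tsum_mul_left]
  refine tsum_congr fun n => ?_
  have h : (x / 2) ^ (2 * (n : ℝ)) = (x ^ 2 / 4) ^ n := by
    rw [Real.rpow_mul (by positivity), Real.rpow_natCast, Real.rpow_two]
    congr 1
    ring
  rw [Real.rpow_add (by positivity), h]
  ring

lemma besselI_pos {ν x : ℝ} (hν : 0 ≤ ν) (hx : 0 < x) : 0 < besselI ν x := by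
  rw [besselI_eq_besselSeries ν hx]
  exact mul_pos (by positivity) (besselSeries_pos hν (by positivity))

lemma hasDerivAt_besselI {ν x : ℝ} (hν : 0 ≤ ν) (hx : 0 < x) :
    HasDerivAt (besselI ν) (besselI (ν + 1) x + ν / x * besselI ν x) x := by
  have h1 : HasDerivAt (fun y : ℝ => (y / 2) ^ ν) (1 / 2 * ν * (x / 2) ^ (ν - 1)) x :=
    ((hasDerivAt_id x).div_const 2).rpow_const (Or.inl (by simp; positivity))
  have h2 : HasDerivAt (fun y : ℝ => y ^ 2 / 4) (x / 2) x := by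
    refine ((hasDerivAt_pow 2 x).div_const 4).congr_deriv ?_
    push_cast
    ring
  have h3 := h1.mul ((hasDerivAt_besselSeries hν (x ^ 2 / 4)).comp x h2)
  refine (h3.congr_of_eventuallyEq ?_).congr_deriv ?_
  · filter_upwards [eventually_gt_nhds hx] with y hy
    exact besselI_eq_besselSeries ν hy
  · rw [besselI_eq_besselSeries ν hx, besselI_eq_besselSeries (ν + 1) hx,
      Real.rpow_add_one (by positivity), Real.rpow_sub_one (by positivity)]
    simp only [Function.comp]
    field_simp
    ring

lemma besselI_recurrence {ν x : ℝ} (hν : 0 ≤ ν) (hx : 0 < x) :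
    besselI ν x = 2 * (ν + 1) / x * besselI (ν + 1) x + besselI (ν + 2) x := by
  rw [besselI_eq_besselSeries ν hx, besselI_eq_besselSeries (ν + 1) hx,
    besselI_eq_besselSeries (ν + 2) hx, besselSeries_recurrence hν,
    Real.rpow_add_one (by positivity), Real.rpow_add (by positivity), Real.rpow_two]
  field_simp
  ring

lemma hasDerivAt_besselI_add_one {ν x : ℝ} (hν : 0 ≤ ν) (hx : 0 < x) :
    HasDerivAt (besselI (ν + 1)) (besselI ν x - (ν + 1) / x * besselI (ν + 1) x) x := by
  refine (hasDerivAt_besselI (ν := ν + 1) (by positivity) hx).congr_deriv ?_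
  rw [besselI_recurrence hν hx, show ν + 1 + 1 = ν + 2 by ring]
  field_simp
  ring

lemma integrable_exp_neg_mul_cosh_mul_exp {x : ℝ} (hx : 0 < x) (μ : ℝ) :
    Integrable fun t : ℝ => Real.exp (-x * Real.cosh t) * Real.exp (μ * t) := by
  have hcosh (t : ℝ) : 1 + t ^ 2 / 4 ≤ Real.cosh t := by
    rw [← Real.cosh_abs, Real.cosh_eq, ← sq_abs t]
    have h1 := Real.quadratic_le_exp_of_nonneg (abs_nonneg t)
    have h2 := Real.add_one_le_exp (-|t|)
    linarith
  refine ((integrable_exp_neg_mul_sq (b := x / 8) (by positivity)).const_mul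
    (Real.exp (2 * μ ^ 2 / x))).mono' (by fun_prop) (Eventually.of_forall fun t => ?_)
  rw [Real.norm_eq_abs, abs_of_pos (by positivity), ← Real.exp_add, ← Real.exp_add]
  refine Real.exp_le_exp.2 ?_
  have h1 := mul_le_mul_of_nonneg_left (hcosh t) hx.le
  have h2 : 0 ≤ (x * t - 4 * μ) ^ 2 / (8 * x) := by positivity
  have h3 : (x * t - 4 * μ) ^ 2 / (8 * x) = x * t ^ 2 / 8 - μ * t + 2 * μ ^ 2 / x := by
    field_simp
    ring
  linarith

lemma integrable_exp_neg_mul_cosh_mul_cosh {x : ℝ} (hx : 0 < x) (μ : ℝ) :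
    Integrable fun t : ℝ => Real.exp (-x * Real.cosh t) * Real.cosh (μ * t) := by
  refine (((integrable_exp_neg_mul_cosh_mul_exp hx μ).add
    (integrable_exp_neg_mul_cosh_mul_exp hx (-μ))).div_const 2).congr
    (Eventually.of_forall fun t => ?_)
  simp only [Pi.add_apply, Real.cosh_eq (μ * t), neg_mul]
  ring

lemma integrable_exp_neg_mul_cosh_mul_sinh {x : ℝ} (hx : 0 < x) (μ : ℝ) :
    Integrable fun t : ℝ => Real.exp (-x * Real.cosh t) * Real.sinh (μ * t) := by
  refine (((integrable_exp_neg_mul_cosh_mul_exp hx μ).sub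
    (integrable_exp_neg_mul_cosh_mul_exp hx (-μ))).div_const 2).congr
    (Eventually.of_forall fun t => ?_)
  simp only [Pi.sub_apply, Real.sinh_eq (μ * t), neg_mul]
  ring

lemma integrable_exp_neg_mul_cosh_mul_cosh_mul_cosh {x : ℝ} (hx : 0 < x) (μ : ℝ) :
    Integrable fun t : ℝ =>
      Real.exp (-x * Real.cosh t) * (Real.cosh t * Real.cosh (μ * t)) := by
  refine (((integrable_exp_neg_mul_cosh_mul_cosh hx (μ + 1)).add
    (integrable_exp_neg_mul_cosh_mul_cosh hx (μ - 1))).div_const 2).congr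
    (Eventually.of_forall fun t => ?_)
  simp only [Pi.add_apply, add_mul, sub_mul, one_mul, Real.cosh_add, Real.cosh_sub]
  ring

lemma integrable_exp_neg_mul_cosh_mul_sinh_mul_sinh {x : ℝ} (hx : 0 < x) (μ : ℝ) :
    Integrable fun t : ℝ =>
      Real.exp (-x * Real.cosh t) * (Real.sinh t * Real.sinh (μ * t)) := by
  refine (((integrable_exp_neg_mul_cosh_mul_cosh hx (μ + 1)).sub
    (integrable_exp_neg_mul_cosh_mul_cosh hx (μ - 1))).div_const 2).congr
    (Eventually.of_forall fun t => ?_)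
  simp only [Pi.sub_apply, add_mul, sub_mul, one_mul, Real.cosh_add, Real.cosh_sub]
  ring

lemma besselK_pos (ν : ℝ) {x : ℝ} (hx : 0 < x) : 0 < besselK ν x := by
  unfold besselK
  have hpos (t : ℝ) : 0 < Real.exp (-x * Real.cosh t) * Real.cosh (ν * t) :=
    mul_pos (Real.exp_pos _) (Real.cosh_pos _)
  rw [setIntegral_pos_iff_support_of_nonneg_ae (Eventually.of_forall fun t => (hpos t).le)
    (integrable_exp_neg_mul_cosh_mul_cosh hx ν).integrableOn,
    Function.support_eq_univ fun t => (hpos t).ne']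
  simp

/-- Integration by parts in the integral defining `K_ν`. -/
lemma mul_integral_sinh_mul_sinh (ν : ℝ) {x : ℝ} (hx : 0 < x) :
    x * ∫ t in Ioi (0 : ℝ), Real.exp (-x * Real.cosh t) * (Real.sinh t * Real.sinh (ν * t))
      = ν * besselK ν x := by
  have hI := (integrable_exp_neg_mul_cosh_mul_sinh_mul_sinh hx ν).const_mul x
  have hJ := (integrable_exp_neg_mul_cosh_mul_cosh hx ν).const_mul ν
  have hder (t : ℝ) : HasDerivAt (fun t => Real.exp (-x * Real.cosh t) * Real.sinh (ν * t))
      (ν * (Real.exp (-x * Real.cosh t) * Real.cosh (ν * t))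
        - x * (Real.exp (-x * Real.cosh t) * (Real.sinh t * Real.sinh (ν * t)))) t := by
    have h1 := ((Real.hasDerivAt_cosh t).const_mul (-x)).exp
    have h2 := ((hasDerivAt_id t).const_mul ν).sinh
    refine (h1.mul h2).congr_deriv ?_
    simp only [id]
    ring
  have hf' := (hJ.sub hI).integrableOn (s := Ioi (0 : ℝ))
  have hlim := tendsto_zero_of_hasDerivAt_of_integrableOn_Ioi (a := 0) (fun t _ => hder t) hf'
    (integrable_exp_neg_mul_cosh_mul_sinh hx ν).integrableOn
  have h := integral_Ioi_of_hasDerivAt_of_tendsto (hder 0).continuousAt.continuousWithinAt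
    (fun t _ => hder t) hf' hlim
  rw [integral_sub hJ.integrableOn hI.integrableOn, integral_const_mul, integral_const_mul] at h
  simp only [mul_zero, Real.sinh_zero, sub_zero] at h
  unfold besselK
  linarith

lemma besselK_add_one (ν : ℝ) {x : ℝ} (hx : 0 < x) :
    besselK (ν + 1) x = (∫ t in Ioi (0 : ℝ),
      Real.exp (-x * Real.cosh t) * (Real.cosh t * Real.cosh (ν * t))) + ν / x * besselK ν x := by
  have h := mul_integral_sinh_mul_sinh ν hx
  rw [div_mul_eq_mul_div, ← h, mul_div_cancel_left₀ _ hx.ne', ← integral_add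
    (integrable_exp_neg_mul_cosh_mul_cosh_mul_cosh hx ν).integrableOn
    (integrable_exp_neg_mul_cosh_mul_sinh_mul_sinh hx ν).integrableOn]
  unfold besselK
  congr 1 with t
  rw [add_mul, one_mul, Real.cosh_add]
  ring

lemma besselK_sub_one (ν : ℝ) {x : ℝ} (hx : 0 < x) :
    besselK (ν - 1) x = (∫ t in Ioi (0 : ℝ),
      Real.exp (-x * Real.cosh t) * (Real.cosh t * Real.cosh (ν * t))) - ν / x * besselK ν x := by
  have h := mul_integral_sinh_mul_sinh ν hx
  rw [div_mul_eq_mul_div, ← h, mul_div_cancel_left₀ _ hx.ne', ← integral_sub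
    (integrable_exp_neg_mul_cosh_mul_cosh_mul_cosh hx ν).integrableOn
    (integrable_exp_neg_mul_cosh_mul_sinh_mul_sinh hx ν).integrableOn]
  unfold besselK
  congr 1 with t
  rw [sub_mul, one_mul, Real.cosh_sub]
  ring

lemma hasDerivAt_besselK_integral (ν : ℝ) {x : ℝ} (hx : 0 < x) :
    HasDerivAt (besselK ν) (-∫ t in Ioi (0 : ℝ),
      Real.exp (-x * Real.cosh t) * (Real.cosh t * Real.cosh (ν * t))) x := by
  rw [← integral_neg]
  refine (hasDerivAt_integral_of_dominated_loc_of_deriv_le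
    (F := fun y t => Real.exp (-y * Real.cosh t) * Real.cosh (ν * t))
    (F' := fun y t => -(Real.exp (-y * Real.cosh t) * (Real.cosh t * Real.cosh (ν * t))))
    (bound := fun t => Real.exp (-(x / 2) * Real.cosh t) * (Real.cosh t * Real.cosh (ν * t)))
    (Ioi_mem_nhds (half_lt_self hx)) ?_ ?_ ?_ ?_ ?_ ?_).2
  · exact Eventually.of_forall fun y => Continuous.aestronglyMeasurable (by fun_prop)
  · exact (integrable_exp_neg_mul_cosh_mul_cosh hx ν).integrableOn
  · exact Continuous.aestronglyMeasurable (by fun_prop)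
  · refine Eventually.of_forall fun t y hy => ?_
    have h1 := Real.cosh_pos t
    have h2 := Real.cosh_pos (ν * t)
    rw [norm_neg, Real.norm_eq_abs, abs_of_pos (by positivity)]
    have hy' : x / 2 ≤ y := le_of_lt hy
    gcongr
  · exact (integrable_exp_neg_mul_cosh_mul_cosh_mul_cosh (half_pos hx) ν).integrableOn
  · refine Eventually.of_forall fun t y _ => ?_
    refine ((((hasDerivAt_id y).neg.mul_const (Real.cosh t)).exp).mul_const
      (Real.cosh (ν * t))).congr_deriv ?_
    simp only [id, Pi.neg_apply]
    ring

lemma hasDerivAt_besselK (ν : ℝ) {x : ℝ} (hx : 0 < x) :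
    HasDerivAt (besselK ν) (ν / x * besselK ν x - besselK (ν + 1) x) x := by
  refine (hasDerivAt_besselK_integral ν hx).congr_deriv ?_
  rw [besselK_add_one ν hx]
  ring

lemma hasDerivAt_besselK_add_one (ν : ℝ) {x : ℝ} (hx : 0 < x) :
    HasDerivAt (besselK (ν + 1)) (-besselK ν x - (ν + 1) / x * besselK (ν + 1) x) x := by
  refine (hasDerivAt_besselK_integral (ν + 1) hx).congr_deriv ?_
  have h := besselK_sub_one (ν + 1) hx
  rw [add_sub_cancel_right] at h
  rw [h]
  ring

lemma besselK_le {ν x : ℝ} (hν : 0 < ν) (hx : 0 < x) :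
    besselK ν x ≤ (2 / x) ^ ν * Real.Gamma ν / 2 := by
  set h : ℝ → ℝ := fun t => Real.exp (-x * Real.cosh t) * Real.exp (ν * t) with hh
  have hint : Integrable h := integrable_exp_neg_mul_cosh_mul_exp hx ν
  have hsymm : besselK ν x = (∫ t, h t) / 2 := by
    have hneg : ∫ t in Ioi (0 : ℝ), h (-t) = ∫ t in Iic (0 : ℝ), h t := by
      simp
    rw [← intervalIntegral.integral_Iic_add_Ioi (b := 0) hint.integrableOn hint.integrableOn,
      ← hneg, ← integral_add hint.comp_neg.integrableOn hint.integrableOn, ← integral_div]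
    unfold besselK
    congr 1 with t
    simp only [hh, Real.cosh_eq (ν * t), Real.cosh_neg]
    ring_nf
  set q : ℝ → ℝ := fun u => u ^ (ν - 1) * Real.exp (-(x / 2 * u)) with hq
  have hqint : IntegrableOn q (Ioi 0) :=
    Integrable.of_integral_ne_zero (by
      rw [hq, Real.integral_rpow_mul_exp_neg_mul_Ioi hν (half_pos hx)]
      exact (mul_pos (by positivity) (Real.Gamma_pos_of_pos hν)).ne')
  have himage : Real.exp '' univ = Ioi 0 := by rw [image_univ, Real.range_exp]
  have hexp : ∀ t ∈ (univ : Set ℝ), HasDerivWithinAt Real.exp (Real.exp t) univ t :=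
    fun t _ => (Real.hasDerivAt_exp t).hasDerivWithinAt
  have hcomp := (integrableOn_image_iff_integrableOn_abs_deriv_smul MeasurableSet.univ hexp
    Real.exp_injective.injOn q).1 (by rwa [himage])
  have hval := integral_image_eq_integral_abs_deriv_smul MeasurableSet.univ hexp
    Real.exp_injective.injOn q
  rw [himage, hq, Real.integral_rpow_mul_exp_neg_mul_Ioi hν (half_pos hx), ← hq,
    Measure.restrict_univ, one_div_div] at hval
  rw [integrableOn_univ] at hcomp
  rw [hsymm, hval]
  refine div_le_div_of_nonneg_right (integral_mono hint hcomp fun t => ?_) two_pos.le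
  have hpow : |Real.exp t| • q (Real.exp t)
      = Real.exp (-(x / 2 * Real.exp t)) * Real.exp (ν * t) := by
    simp only [hq, smul_eq_mul, abs_of_pos (Real.exp_pos t), ← Real.exp_mul]
    rw [← mul_assoc, ← Real.exp_add, mul_comm]
    ring_nf
  rw [hpow, hh]
  refine mul_le_mul_of_nonneg_right (Real.exp_le_exp.2 ?_) (Real.exp_pos _).le
  rw [Real.cosh_eq]
  have := mul_pos hx (Real.exp_pos (-t))
  linarith

/-- One half of the Wronskian identity `x (I_ν K_{ν+1} + I_{ν+1} K_ν) = 1`. -/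
lemma besselI_mul_besselK_add_le_one {ν x : ℝ} (hν : 0 < ν) (hx : 0 < x) :
    x * (besselI ν x * besselK (ν + 1) x + besselI (ν + 1) x * besselK ν x) ≤ 1 := by
  set W : ℝ → ℝ := fun y =>
    y * (besselI ν y * besselK (ν + 1) y + besselI (ν + 1) y * besselK ν y) with hW
  have hder : ∀ y ∈ Ioi (0 : ℝ), HasDerivAt W 0 y := by
    intro y hy
    have hy : 0 < y := hy
    refine ((hasDerivAt_id y).mul
      (((hasDerivAt_besselI hν.le hy).mul (hasDerivAt_besselK_add_one ν hy)).add
      ((hasDerivAt_besselI_add_one hν.le hy).mul (hasDerivAt_besselK ν hy)))).congr_deriv ?_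
    simp only [id, Pi.add_apply, Pi.mul_apply]
    field_simp
    ring
  have hconst : ∀ y ∈ Ioi (0 : ℝ), W x = W y := fun y hy =>
    isOpen_Ioi.is_const_of_deriv_eq_zero isPreconnected_Ioi
      (fun z hz => (hder z hz).differentiableAt.differentiableWithinAt)
      (fun z hz => (hder z hz).deriv) hx hy
  set U : ℝ → ℝ := fun y => Real.Gamma (ν + 1) * besselSeries ν (y ^ 2 / 4)
    + y ^ 2 / 4 * Real.Gamma ν * besselSeries (ν + 1) (y ^ 2 / 4) with hU
  have hle : ∀ y ∈ Ioi (0 : ℝ), W y ≤ U y := by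
    intro y hy
    have hy : 0 < y := hy
    have hI := besselI_pos hν.le hy
    have hI' := besselI_pos (ν := ν + 1) (by positivity) hy
    have hpow : (2 / y) ^ ν = ((y / 2) ^ ν)⁻¹ := by
      rw [← Real.inv_rpow (by positivity), inv_div]
    have hp : 0 < (y / 2) ^ ν := by positivity
    calc W y ≤ y * (besselI ν y * ((2 / y) ^ (ν + 1) * Real.Gamma (ν + 1) / 2)
          + besselI (ν + 1) y * ((2 / y) ^ ν * Real.Gamma ν / 2)) := by
          simp only [hW]
          gcongr
          · exact besselK_le (by positivity) hy
          · exact besselK_le hν hy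
      _ = U y := by
          rw [besselI_eq_besselSeries ν hy, besselI_eq_besselSeries (ν + 1) hy,
            Real.rpow_add_one (by positivity), Real.rpow_add_one (by positivity), hpow]
          simp only [hU]
          field_simp
          ring
  have hcont (μ : ℝ) (hμ : 0 ≤ μ) : Continuous (besselSeries μ) :=
    continuous_iff_continuousAt.2 fun z => (hasDerivAt_besselSeries hμ z).continuousAt
  have hUcont : Continuous U := by
    have h1 := hcont ν hν.le
    have h2 := hcont (ν + 1) (by positivity)
    fun_prop
  have hU0 : U 0 = 1 := by
    simp [hU, besselSeries_zero, (Real.Gamma_pos_of_pos (show 0 < ν + 1 by positivity)).ne']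
  have hlim : Tendsto U (nhdsWithin 0 (Ioi 0)) (nhds 1) :=
    hU0 ▸ hUcont.continuousAt.tendsto.mono_left nhdsWithin_le_nhds
  refine ge_of_tendsto hlim ?_
  filter_upwards [self_mem_nhdsWithin] with y hy
  exact (hconst y hy).trans_le (hle y hy)

lemma besselI_add_one_ge {ν x : ℝ} (hν : 1 / 2 ≤ ν) (hx : 0 < x) :
    (x - (ν + 1 / 2)) * besselI ν x ≤ x * besselI (ν + 1) x := by
  have hν0 : 0 ≤ ν := by linarith
  set D : ℝ → ℝ := fun y => Real.exp y * √y *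
    (besselI (ν + 1) y + ((ν + 1 / 2) / y - 1) * besselI ν y) with hD
  have hder : ∀ y ∈ Ioi (0 : ℝ), HasDerivAt D
      (Real.exp y * √y * ((ν ^ 2 - 1 / 4) / y ^ 2 * besselI ν y)) y := by
    intro y hy
    have hy : 0 < y := hy
    have hs := Real.sqrt_pos.2 hy
    have hq : HasDerivAt (fun y : ℝ => (ν + 1 / 2) / y - 1) (-(ν + 1 / 2) / y ^ 2) y := by
      refine (((hasDerivAt_inv hy.ne').const_mul (ν + 1 / 2)).sub_const 1).congr_deriv ?_
      field_simp
    refine (((Real.hasDerivAt_exp y).mul (Real.hasDerivAt_sqrt hy.ne')).mul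
      ((hasDerivAt_besselI_add_one hν0 hy).add
        (hq.mul (hasDerivAt_besselI hν0 hy)))).congr_deriv ?_
    have hinv : 1 / (2 * √y) = √y / (2 * y) := by
      rw [div_eq_div_iff (by positivity) (by positivity)]
      linear_combination (-2) * Real.mul_self_sqrt hy.le
    simp only [Pi.add_apply, Pi.mul_apply, hinv]
    field_simp
    ring
  have hmono : MonotoneOn D (Ioi 0) := by
    refine monotoneOn_of_deriv_nonneg (convex_Ioi 0)
      (fun y hy => (hder y hy).continuousAt.continuousWithinAt) ?_ ?_ <;>
      rw [interior_Ioi]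
    · exact fun y hy => (hder y hy).differentiableAt.differentiableWithinAt
    · intro y hy
      have hy0 : 0 < y := hy
      rw [(hder y hy).deriv]
      have h1 := besselI_pos hν0 hy0
      have h2 : 0 ≤ ν ^ 2 - 1 / 4 := by nlinarith
      positivity
  have hsmall {y : ℝ} (hy : 0 < y) (hyν : y ≤ ν + 1 / 2) : 0 ≤ D y := by
    have h1 := besselI_pos hν0 hy
    have h2 := besselI_pos (ν := ν + 1) (by positivity) hy
    have h3 : 0 ≤ (ν + 1 / 2) / y - 1 := by
      rw [sub_nonneg, le_div_iff₀ hy]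
      linarith
    positivity
  have hDx : 0 ≤ D x := by
    have hmin : 0 < min x (ν + 1 / 2) := lt_min hx (by linarith)
    exact (hsmall hmin (min_le_right _ _)).trans (hmono hmin hx (min_le_left _ _))
  have hfac : 0 < Real.exp x * √x := mul_pos (Real.exp_pos x) (Real.sqrt_pos.2 hx)
  have h := mul_nonneg hx.le (nonneg_of_mul_nonneg_right hDx hfac)
  have heq : x * (besselI (ν + 1) x + ((ν + 1 / 2) / x - 1) * besselI ν x)
      = x * besselI (ν + 1) x - (x - (ν + 1 / 2)) * besselI ν x := by
    field_simp
    ring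
  linarith

lemma besselK_antitoneOn (ν : ℝ) : AntitoneOn (besselK ν) (Ioi 0) := by
  intro x hx y hy hxy
  refine integral_mono (integrable_exp_neg_mul_cosh_mul_cosh hy ν).integrableOn
    (integrable_exp_neg_mul_cosh_mul_cosh hx ν).integrableOn fun t => ?_
  have h1 := Real.cosh_pos t
  have h2 := Real.cosh_pos (ν * t)
  dsimp only
  gcongr

lemma besselK_add_one_ge {ν x : ℝ} (hν : 1 / 2 ≤ ν) (hx : 0 < x) :
    (x + (ν + 1 / 2)) * besselK ν x ≤ x * besselK (ν + 1) x := by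
  set D : ℝ → ℝ := fun y => Real.exp (-y) * √y *
    (besselK (ν + 1) y - ((ν + 1 / 2) / y + 1) * besselK ν y) with hD
  have hder : ∀ y ∈ Ioi (0 : ℝ), HasDerivAt D
      (-(Real.exp (-y) * √y * ((ν ^ 2 - 1 / 4) / y ^ 2 * besselK ν y))) y := by
    intro y hy
    have hy : 0 < y := hy
    have hs := Real.sqrt_pos.2 hy
    have hq : HasDerivAt (fun y : ℝ => (ν + 1 / 2) / y + 1) (-(ν + 1 / 2) / y ^ 2) y := by
      refine (((hasDerivAt_inv hy.ne').const_mul (ν + 1 / 2)).add_const 1).congr_deriv ?_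
      field_simp
    refine (((hasDerivAt_neg y).exp.mul (Real.hasDerivAt_sqrt hy.ne')).mul
      ((hasDerivAt_besselK_add_one ν hy).sub (hq.mul (hasDerivAt_besselK ν hy)))).congr_deriv ?_
    have hinv : 1 / (2 * √y) = √y / (2 * y) := by
      rw [div_eq_div_iff (by positivity) (by positivity)]
      linear_combination (-2) * Real.mul_self_sqrt hy.le
    simp only [Pi.sub_apply, Pi.mul_apply, hinv]
    field_simp
    ring
  have hanti : AntitoneOn D (Ioi 0) := by
    refine antitoneOn_of_deriv_nonpos (convex_Ioi 0)
      (fun y hy => (hder y hy).continuousAt.continuousWithinAt) ?_ ?_ <;>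
      rw [interior_Ioi]
    · exact fun y hy => (hder y hy).differentiableAt.differentiableWithinAt
    · intro y hy
      have hy0 : 0 < y := hy
      rw [(hder y hy).deriv, neg_nonpos]
      have h1 := besselK_pos ν hy0
      have h2 : 0 ≤ ν ^ 2 - 1 / 4 := by nlinarith
      positivity
  set C : ℝ := (ν + 1 / 2 + 1) * besselK ν 1
  have hlower {y : ℝ} (hy : 1 ≤ y) : -(C * (y ^ 1 * Real.exp (-y))) ≤ D y := by
    have hy0 : 0 < y := by linarith
    have h1 := besselK_pos (ν + 1) hy0
    have h2 := besselK_pos ν hy0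
    have h3 : besselK ν y ≤ besselK ν 1 := besselK_antitoneOn ν (mem_Ioi.2 one_pos) hy0 hy
    have h4 : (ν + 1 / 2) / y ≤ ν + 1 / 2 := div_le_self (by linarith) hy
    have h5 : √y ≤ y := Real.sqrt_le_iff.2 ⟨hy0.le, by nlinarith⟩
    have h6 : ((ν + 1 / 2) / y + 1) * besselK ν y ≤ C := by
      simp only [C]
      gcongr
    have hC : 0 ≤ C := mul_nonneg (by linarith) (besselK_pos ν one_pos).le
    have h7 : Real.exp (-y) * √y * C ≤ Real.exp (-y) * y * C := by gcongr
    have h8 : Real.exp (-y) * √y * (-C) ≤ D y := by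
      simp only [hD]
      gcongr
      linarith
    linarith
  have hDx : 0 ≤ D x := by
    have hlim : Tendsto (fun y : ℝ => -(C * (y ^ 1 * Real.exp (-y)))) atTop (nhds 0) := by
      simpa using ((Real.tendsto_pow_mul_exp_neg_atTop_nhds_zero 1).const_mul C).neg
    refine le_of_tendsto hlim ?_
    filter_upwards [eventually_ge_atTop 1, eventually_ge_atTop x] with y h1 hxy
    exact (hlower h1).trans (hanti hx (lt_of_lt_of_le hx hxy) hxy)
  have hfac : 0 < Real.exp (-x) * √x := mul_pos (Real.exp_pos _) (Real.sqrt_pos.2 hx)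
  have h := mul_nonneg hx.le (nonneg_of_mul_nonneg_right hDx hfac)
  have heq : x * (besselK (ν + 1) x - ((ν + 1 / 2) / x + 1) * besselK ν x)
      = x * besselK (ν + 1) x - (x + (ν + 1 / 2)) * besselK ν x := by
    field_simp
    ring
  linarith

lemma besselI_mul_besselK_le {ν x : ℝ} (hν : 1 / 2 ≤ ν) (hx : 0 < x) :
    besselI ν x * besselK ν x ≤ 1 / (2 * x) := by
  have hI := besselI_pos (ν := ν) (by linarith) hx
  have hK := besselK_pos ν hx
  have h1 := besselI_mul_besselK_add_le_one (ν := ν) (by linarith) hx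
  have h2 := mul_le_mul_of_nonneg_right (besselI_add_one_ge hν hx) hK.le
  have h3 := mul_le_mul_of_nonneg_left (besselK_add_one_ge hν hx) hI.le
  rw [le_div_iff₀ (by positivity)]
  linarith

theorem stmt10 (ν x : ℝ) (hν : 1 / 2 ≤ ν) (hx : 0 < x) :
    besselI ν x * besselK ν x - 1 / (2 * x) < 1 / (16 * x ^ 2) := by
  have h := besselI_mul_besselK_le hν hx
  have hpos : 0 < 1 / (16 * x ^ 2) := by positivity
  linarith
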